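/- arXiv:2507.04579 — 4 statements merged into one kernel-verified Lean document; each statement's English description precedes it below -/
import Mathlib

section
/- Let s ≥ 2, n ≥ 3(s+1), and let H be a 3-graph on vertex set [n] with matching number ν(H) ≤ s. Then there exist an integer i with 0 ≤ i ≤ s and sets A ⊆ S ⊆ [n] with |A| = s − i and |S| = s such that deg_H(x) ≤ (s+2i)n for every vertex x ∉ A, and |H| ≤ Σ_{v ∈ A} deg_H(v, [n]∖S) + Σ_{{u,v} ⊆ A, u ≠ v} deg_H(u,v) + i·s·n + 6i²n. -/
open Finset

/-- The matching number of `H` is at most `s`: every family of pairwise disjoint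
edges of `H` has at most `s` members. -/
def MatchingNumLE {n : ℕ} (H : Finset (Finset (Fin n))) (s : ℕ) : Prop :=
  ∀ M ⊆ H, (∀ e ∈ M, ∀ f ∈ M, e ≠ f → Disjoint e f) → M.card ≤ s

/-- `H` is a 3-graph: every edge is a 3-element subset of the vertex set. -/
def IsThreeGraph {n : ℕ} (H : Finset (Finset (Fin n))) : Prop :=
  ∀ e ∈ H, e.card = 3

/-- The degree of a vertex `u` in the 3-graph `H`. -/
def degH {n : ℕ} (H : Finset (Finset (Fin n))) (u : Fin n) : ℕ :=
  (H.filter (fun e => u ∈ e)).card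

/-- `degW H u W` is the number of pairs `{v, w} ⊆ W` with `{u, v, w} ∈ H`. -/
def degW {n : ℕ} (H : Finset (Finset (Fin n))) (u : Fin n) (W : Finset (Fin n)) : ℕ :=
  ((Finset.powersetCard 2 W).filter (fun pr => insert u pr ∈ H)).card

/-- At most `n` edges contain a given pair, counted through the third vertex. -/
theorem card_filter_pair_subset_le {n : ℕ} {H : Finset (Finset (Fin n))} (h3 : IsThreeGraph H)
    {p : Finset (Fin n)} (hp : p.card = 2) :
    (H.filter (p ⊆ ·)).card ≤ (univ.filter (fun w : Fin n => insert w p ∈ H)).card := by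
  refine (card_le_card ?_).trans (card_image_le (f := fun w => insert w p))
  intro e he
  obtain ⟨heH, hpe⟩ := mem_filter.1 he
  have h1 : (e \ p).card = 1 := by
    rw [card_sdiff_of_subset hpe, h3 e heH, hp]
  obtain ⟨w, hw⟩ := card_eq_one.1 h1
  have hins : insert w p = e := by
    rw [insert_eq, ← hw, sdiff_union_of_subset hpe]
  exact mem_image.2 ⟨w, by simp [hins, heH], hins⟩

theorem card_filter_pair_subset_le_card {n : ℕ} {H : Finset (Finset (Fin n))}
    (h3 : IsThreeGraph H) {p : Finset (Fin n)} (hp : p.card = 2) :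
    (H.filter (p ⊆ ·)).card ≤ n :=
  (card_filter_pair_subset_le h3 hp).trans ((card_le_univ _).trans_eq (Fintype.card_fin n))

/-- A vertex of degree greater than `|U| n` lies on an edge avoiding `U`. -/
theorem exists_edge_disjoint_of_lt_degH {n : ℕ} {H : Finset (Finset (Fin n))}
    (h3 : IsThreeGraph H) {v : Fin n} {U : Finset (Fin n)} (hv : v ∉ U)
    (hdeg : U.card * n < degH H v) : ∃ e ∈ H, v ∈ e ∧ Disjoint e U := by
  by_contra! hcon
  have hsub : H.filter (v ∈ ·) ⊆ U.biUnion (fun u => H.filter (({v, u} : Finset (Fin n)) ⊆ ·)) := by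
    intro e he
    obtain ⟨heH, hve⟩ := mem_filter.1 he
    obtain ⟨u, hue, huU⟩ := not_disjoint_iff.1 (hcon e heH hve)
    refine mem_biUnion.2 ⟨u, huU, mem_filter.2 ⟨heH, ?_⟩⟩
    simp [insert_subset_iff, hve, hue]
  have hle := (card_le_card hsub).trans (card_biUnion_le_card_mul U _ n fun u hu =>
    card_filter_pair_subset_le_card h3 (card_pair (by rintro rfl; exact hv hu)))
  exact absurd hdeg (not_lt.2 hle)

theorem card_biUnion_matching {n : ℕ} {M : Finset (Finset (Fin n))}
    (hM3 : ∀ e ∈ M, e.card = 3) (hM : ∀ e ∈ M, ∀ f ∈ M, e ≠ f → Disjoint e f) :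
    (M.biUnion id).card = 3 * M.card := by
  rw [card_biUnion (t := id) (fun e he f hf hef => hM e he f hf hef)]
  simp only [id, sum_congr rfl hM3, sum_const, smul_eq_mul, mul_comm]

/-- If for every `j ≥ k` many vertices have degree above `(s + 2j) n`, then some set `T` of
`s + 1 - k` of them is avoided by no matching of size `k`, since such a matching extends greedily
through `T`. -/
theorem exists_blocking_set {n s : ℕ} {H : Finset (Finset (Fin n))} (h3 : IsThreeGraph H)
    (hν : MatchingNumLE H s) (m : ℕ) : ∀ k, k + m = s + 1 →
    (∀ j, k ≤ j → j ≤ s → s - j < (univ.filter (fun x => (s + 2 * j) * n < degH H x)).card) →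
    ∃ T : Finset (Fin n), T.card = m ∧ (∀ x ∈ T, (s + 2 * k) * n < degH H x) ∧
      ∀ M ⊆ H, (∀ e ∈ M, ∀ f ∈ M, e ≠ f → Disjoint e f) → (∀ e ∈ M, Disjoint e T) →
        M.card ≠ k := by
  induction m with
  | zero =>
    intro k hk _
    refine ⟨∅, rfl, by simp, fun M hMH hM _ hcard => ?_⟩
    have := hν M hMH hM
    omega
  | succ m ih =>
    intro k hk hB
    obtain ⟨T, hTcard, hTdeg, hT⟩ := ih (k + 1) (by omega) (fun j hj => hB j (by omega))
    have hlt : T.card < (univ.filter (fun x => (s + 2 * k) * n < degH H x)).card := by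
      have := hB k le_rfl (by omega)
      omega
    obtain ⟨v, hvB, hvT⟩ := exists_mem_notMem_of_card_lt_card hlt
    have hvdeg : (s + 2 * k) * n < degH H v := (mem_filter.1 hvB).2
    refine ⟨insert v T, by rw [card_insert_of_notMem hvT, hTcard], ?_, ?_⟩
    · intro x hx
      rcases mem_insert.1 hx with rfl | hx
      · exact hvdeg
      · exact lt_of_le_of_lt (Nat.mul_le_mul_right n (by omega)) (hTdeg x hx)
    · intro M hMH hM hMT hMk
      have hvM : v ∉ M.biUnion id := by
        intro h
        obtain ⟨e, he, hve⟩ := mem_biUnion.1 h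
        exact disjoint_left.1 (hMT e he) hve (mem_insert_self v T)
      have hUcard : (T ∪ M.biUnion id).card ≤ s + 2 * k := by
        have h1 := card_union_le T (M.biUnion id)
        have h2 := card_biUnion_matching (fun e he => h3 e (hMH he)) hM
        omega
      obtain ⟨e, heH, hve, heU⟩ := exists_edge_disjoint_of_lt_degH h3
        (U := T ∪ M.biUnion id) (by simpa [hvT] using hvM)
        (lt_of_le_of_lt (Nat.mul_le_mul_right n hUcard) hvdeg)
      rw [disjoint_union_right] at heU
      have heM : ∀ f ∈ M, Disjoint e f := fun f hf =>
        heU.2.mono_right (subset_biUnion_of_mem id hf)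
      have heM' : e ∉ M := fun h => hvM (mem_biUnion.2 ⟨e, h, hve⟩)
      refine hT (insert e M) (insert_subset heH hMH) ?_ ?_ (by rw [card_insert_of_notMem heM', hMk])
      · intro f hf g hg hfg
        rcases mem_insert.1 hf with rfl | hf' <;> rcases mem_insert.1 hg with rfl | hg'
        · exact absurd rfl hfg
        · exact heM g hg'
        · exact (heM f hf').symm
        · exact hM f hf' g hg' hfg
      · intro f hf
        rcases mem_insert.1 hf with rfl | hf
        · exact heU.1
        · exact (hMT f hf).mono_right (subset_insert v T)

/-- The smaller of two cross-intersecting graphs on `n ≥ 4` vertices has at most `n` edges. -/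
theorem card_le_of_cross_intersecting {n : ℕ} (hn : 4 ≤ n) {E F : Finset (Finset (Fin n))}
    (hE : ∀ P ∈ E, P.card = 2) (hF : ∀ Q ∈ F, Q.card = 2)
    (hEF : ∀ P ∈ E, ∀ Q ∈ F, ¬ Disjoint P Q) (hcard : E.card ≤ F.card) : E.card ≤ n := by
  by_cases hint : (E : Set (Finset (Fin n))).Intersecting
  · have := erdos_ko_rado hint (r := 2) (fun P hP => hE P hP) (by omega)
    simp only [Nat.add_one_sub_one, Nat.choose_one_right] at this
    omega
  · simp only [Set.Intersecting, not_forall, not_not] at hint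
    obtain ⟨P, hP, Q, hQ, hPQ⟩ := hint
    have hsub : F ⊆ (P ×ˢ Q).image (fun x => {x.1, x.2}) := by
      intro R hR
      obtain ⟨p, hpP, hpR⟩ := not_disjoint_iff.1 (hEF P hP R hR)
      obtain ⟨q, hqQ, hqR⟩ := not_disjoint_iff.1 (hEF Q hQ R hR)
      have hpq : p ≠ q := by rintro rfl; exact disjoint_left.1 hPQ hpP hqQ
      refine mem_image.2 ⟨(p, q), mem_product.2 ⟨hpP, hqQ⟩, ?_⟩
      exact eq_of_subset_of_card_le (by simp [insert_subset_iff, hpR, hqR])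
        (by rw [hF R hR, card_pair hpq])
    have := (card_le_card hsub).trans card_image_le
    rw [card_product, hE P hP, hE Q hQ] at this
    omega

/-- Edges of `G` meeting `C` in the single vertex `v`. -/
def privateEdges {n : ℕ} (G : Finset (Finset (Fin n))) (C : Finset (Fin n)) (v : Fin n) :
    Finset (Finset (Fin n)) :=
  G.filter (fun f => f ∩ C = {v})

/-- In a maximum matching, two vertices of one edge cannot both have many private edges. -/
theorem card_privateEdges_le {n : ℕ} (hn : 4 ≤ n) {G : Finset (Finset (Fin n))}
    (h3 : IsThreeGraph G) {M : Finset (Finset (Fin n))} (hMG : M ⊆ G)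
    (hM : ∀ e ∈ M, ∀ f ∈ M, e ≠ f → Disjoint e f) (hmax : MatchingNumLE G M.card)
    {e : Finset (Fin n)} (he : e ∈ M) {v a : Fin n} (hv : v ∈ e) (ha : a ∈ e) (hva : v ≠ a)
    (hle : (privateEdges G (M.biUnion id) v).card ≤ (privateEdges G (M.biUnion id) a).card) :
    (privateEdges G (M.biUnion id) v).card ≤ n := by
  set C := M.biUnion id with hC
  have hmem : ∀ {x f}, f ∈ privateEdges G C x → x ∈ f := by
    intro x f hf
    have := (mem_filter.1 hf).2
    exact (mem_inter.1 (this ▸ mem_singleton_self x)).1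
  have hcard : ∀ x, ((privateEdges G C x).image (·.erase x)).card = (privateEdges G C x).card := by
    intro x
    refine card_image_of_injOn fun f hf g hg hfg => ?_
    rw [← insert_erase (hmem hf), ← insert_erase (hmem hg)]
    exact congrArg (insert x) hfg
  have htwo : ∀ x, ∀ P ∈ (privateEdges G C x).image (·.erase x), P.card = 2 := by
    intro x P hP
    obtain ⟨f, hf, rfl⟩ := mem_image.1 hP
    simp [card_erase_of_mem (hmem hf), h3 f (mem_filter.1 hf).1]
  rw [← hcard v]
  refine card_le_of_cross_intersecting hn (htwo v) (htwo a) ?_ (by rwa [hcard, hcard])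
  intro P hP Q hQ hPQ
  obtain ⟨f, hf, rfl⟩ := mem_image.1 hP
  obtain ⟨g, hg, rfl⟩ := mem_image.1 hQ
  have honly : ∀ {x h}, h ∈ privateEdges G C x → ∀ y ∈ h, y ∈ C → y = x := by
    intro x h hh y hy hyC
    have := (mem_filter.1 hh).2
    exact mem_singleton.1 (this ▸ mem_inter.2 ⟨hy, hyC⟩)
  have hin : ∀ {h}, h ∈ M → ∀ y ∈ h, y ∈ C := fun {h} hh y hy => mem_biUnion.2 ⟨h, hh, hy⟩
  have hfg : Disjoint f g := by
    refine disjoint_left.2 fun y hyf hyg => ?_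
    by_cases h1 : y = v
    · exact hva (h1 ▸ honly hg y hyg (h1 ▸ hin he v hv))
    by_cases h2 : y = a
    · exact h1 (honly hf y hyf (h2 ▸ hin he a ha))
    exact disjoint_left.1 hPQ (mem_erase.2 ⟨h1, hyf⟩) (mem_erase.2 ⟨h2, hyg⟩)
  have hdisj : ∀ {x h}, x ∈ e → h ∈ privateEdges G C x → ∀ k ∈ M.erase e, Disjoint h k := by
    intro x h hx hh k hk
    obtain ⟨hke, hkM⟩ := mem_erase.1 hk
    refine disjoint_left.2 fun y hyh hyk => ?_
    have := honly hh y hyh (hin hkM y hyk)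
    exact disjoint_left.1 (hM k hkM e he hke) hyk (this ▸ hx)
  have hnot : ∀ {x h}, x ∈ e → h ∈ privateEdges G C x → h ∉ M.erase e := by
    intro x h hx hh hk
    exact disjoint_left.1 (hdisj hx hh h hk) (hmem hh) (hmem hh)
  have hne : f ≠ g := by
    rintro rfl
    exact disjoint_left.1 hfg (hmem hf) (hmem hf)
  have hbig := hmax (insert f (insert g (M.erase e)))
    (insert_subset (mem_filter.1 hf).1 (insert_subset (mem_filter.1 hg).1
      ((erase_subset e M).trans hMG))) (by
      intro h hh k hk hhk
      simp only [mem_insert] at hh hk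
      rcases hh with rfl | rfl | hh' <;> rcases hk with rfl | rfl | hk'
      · exact absurd rfl hhk
      · exact hfg
      · exact hdisj hv hf k hk'
      · exact hfg.symm
      · exact absurd rfl hhk
      · exact hdisj ha hg k hk'
      · exact (hdisj hv hf h hh').symm
      · exact (hdisj ha hg h hh').symm
      · exact hM h (mem_of_mem_erase hh') k (mem_of_mem_erase hk') hhk)
  rw [card_insert_of_notMem (by simp only [mem_insert, not_or]; exact ⟨hne, hnot hv hf⟩),
    card_insert_of_notMem (hnot ha hg), card_erase_of_mem he] at hbig
  have := card_pos.2 ⟨e, he⟩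
  omega

/-- A 3-graph with matching number at most `i` has a set `R` of at most `i` vertices such that
at most `4 i² n` edges avoid `R`. -/
theorem exists_card_filter_disjoint_le {n i : ℕ} (hn : 4 ≤ n) {G : Finset (Finset (Fin n))}
    (h3 : IsThreeGraph G) (hν : MatchingNumLE G i) :
    ∃ R : Finset (Fin n), R.card ≤ i ∧
      (G.filter (Disjoint · R)).card ≤ 4 * i ^ 2 * n := by
  obtain ⟨M, hMmem, hMmax⟩ := exists_max_image
    (G.powerset.filter (fun M => ∀ e ∈ M, ∀ f ∈ M, e ≠ f → Disjoint e f)) card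
    ⟨∅, by simp⟩
  simp only [mem_filter, mem_powerset, and_imp] at hMmem hMmax
  obtain ⟨hMG, hM⟩ := hMmem
  have hMi : M.card ≤ i := hν M hMG hM
  have hmax : MatchingNumLE G M.card := hMmax
  set C := M.biUnion id with hC
  have hCcard : C.card = 3 * M.card := card_biUnion_matching (fun e he => h3 e (hMG he)) hM
  have hex : ∀ e ∈ M, ∃ a ∈ e, ∀ v ∈ e, (privateEdges G C v).card ≤ (privateEdges G C a).card :=
    fun e he => exists_max_image e _ (card_pos.1 (by rw [h3 e (hMG he)]; norm_num))
  have : NeZero n := ⟨by omega⟩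
  choose! a ha hamax using hex
  have hRC : M.image a ⊆ C := by
    intro x hx
    obtain ⟨e, he, rfl⟩ := mem_image.1 hx
    exact mem_biUnion.2 ⟨e, he, ha e he⟩
  have hRcard : (M.image a).card = M.card := by
    refine card_image_of_injOn fun e he f hf hef => ?_
    by_contra hne
    exact disjoint_left.1 (hM e he f hf hne) (ha e he) (hef ▸ ha f hf)
  refine ⟨M.image a, hRcard.trans_le hMi, ?_⟩
  have hDcard : (C \ M.image a).card = 2 * M.card := by
    rw [card_sdiff_of_subset hRC, hCcard, hRcard]
    omega
  have hsub : G.filter (Disjoint · (M.image a)) ⊆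
      ((C \ M.image a).biUnion (privateEdges G C)) ∪
      ((powersetCard 2 (C \ M.image a)).biUnion (fun p => G.filter (p ⊆ ·))) := by
    intro f hf
    obtain ⟨hfG, hfR⟩ := mem_filter.1 hf
    have hfC : (f ∩ C).Nonempty := by
      rw [nonempty_iff_ne_empty, Ne, ← disjoint_iff_inter_eq_empty]
      intro hdis
      have hfM : ∀ e ∈ M, Disjoint f e := fun e he =>
        hdis.mono_right (subset_biUnion_of_mem id he)
      have hfn : f ∉ M := by
        intro h
        have h0 := h3 f hfG
        rw [disjoint_self.1 (hfM f h)] at h0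
        simp at h0
      have := hmax (insert f M) (insert_subset hfG hMG) (by
        intro h hh k hk hhk
        rcases mem_insert.1 hh with rfl | hh' <;> rcases mem_insert.1 hk with rfl | hk'
        · exact absurd rfl hhk
        · exact hfM k hk'
        · exact (hfM h hh').symm
        · exact hM h hh' k hk' hhk)
      rw [card_insert_of_notMem hfn] at this
      omega
    have hout : ∀ x ∈ f ∩ C, x ∈ C \ M.image a := fun x hx =>
      mem_sdiff.2 ⟨(mem_inter.1 hx).2, disjoint_left.1 hfR (mem_inter.1 hx).1⟩
    by_cases h1 : (f ∩ C).card = 1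
    · obtain ⟨v, hv⟩ := card_eq_one.1 h1
      exact mem_union_left _ (mem_biUnion.2
        ⟨v, hout v (hv ▸ mem_singleton_self v), mem_filter.2 ⟨hfG, hv⟩⟩)
    · have hpos := card_pos.2 hfC
      obtain ⟨p, hp, hp2⟩ := exists_subset_card_eq (show 2 ≤ (f ∩ C).card by omega)
      exact mem_union_right _ (mem_biUnion.2 ⟨p, mem_powersetCard.2
        ⟨fun x hx => hout x (hp hx), hp2⟩, mem_filter.2 ⟨hfG, hp.trans inter_subset_left⟩⟩)
  have hone : ((C \ M.image a).biUnion (privateEdges G C)).card ≤ 2 * M.card * n := by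
    rw [← hDcard]
    refine card_biUnion_le_card_mul _ _ _ fun v hv => ?_
    obtain ⟨hvC, hvR⟩ := mem_sdiff.1 hv
    obtain ⟨e, he, hve⟩ := mem_biUnion.1 hvC
    exact card_privateEdges_le hn h3 hMG hM hmax he hve (ha e he)
      (by rintro rfl; exact hvR (mem_image_of_mem a he)) (hamax e he v hve)
  have htwo : ((powersetCard 2 (C \ M.image a)).biUnion (fun p => G.filter (p ⊆ ·))).card ≤
      (2 * M.card).choose 2 * n := by
    rw [← hDcard, ← card_powersetCard]
    exact card_biUnion_le_card_mul _ _ _ fun p hp =>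
      card_filter_pair_subset_le_card h3 (mem_powersetCard.1 hp).2
  have hchoose : (2 * M.card).choose 2 + 2 * M.card ≤ 4 * M.card ^ 2 := by
    rw [Nat.choose_two_right, mul_assoc, Nat.mul_div_cancel_left _ (by norm_num)]
    rcases Nat.eq_zero_or_pos M.card with h | h
    · simp [h]
    · obtain ⟨t, ht⟩ : ∃ t, M.card = t + 1 := ⟨M.card - 1, by omega⟩
      rw [ht, show 2 * (t + 1) - 1 = 2 * t + 1 by omega]
      nlinarith
  calc (G.filter (Disjoint · (M.image a))).card
      ≤ 2 * M.card * n + (2 * M.card).choose 2 * n :=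
        (card_le_card hsub).trans ((card_union_le _ _).trans (add_le_add hone htwo))
    _ = ((2 * M.card).choose 2 + 2 * M.card) * n := by ring
    _ ≤ 4 * M.card ^ 2 * n := Nat.mul_le_mul_right n hchoose
    _ ≤ 4 * i ^ 2 * n := by gcongr

/-- Some level `i` has exactly `s - i` vertices of degree above `(s + 2i) n`, and deleting them
leaves matching number at most `i`. -/
theorem exists_heavy_level {n s : ℕ} {H : Finset (Finset (Fin n))} (h3 : IsThreeGraph H)
    (hν : MatchingNumLE H s) :
    ∃ (i : ℕ) (A : Finset (Fin n)), i ≤ s ∧ A.card = s - i ∧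
      (∀ x, x ∉ A → degH H x ≤ (s + 2 * i) * n) ∧
      MatchingNumLE (H.filter (Disjoint · A)) i := by
  set B : ℕ → Finset (Fin n) := fun j => univ.filter (fun x => (s + 2 * j) * n < degH H x) with hB
  have hne : ((range (s + 1)).filter (fun j => (B j).card ≤ s - j)).Nonempty := by
    by_contra hcon
    rw [not_nonempty_iff_eq_empty, filter_eq_empty_iff] at hcon
    obtain ⟨T, -, -, hT⟩ := exists_blocking_set h3 hν (s + 1) 0 (by omega)
      (fun j _ hj => not_le.1 (hcon (mem_range.2 (by omega))))
    exact hT ∅ (by simp) (by simp) (by simp) rfl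
  obtain ⟨i, hi, himax⟩ := exists_max_image _ id hne
  simp only [mem_filter, mem_range, id, and_imp] at hi himax
  obtain ⟨his, hBi⟩ := hi
  obtain ⟨T, hTcard, hTdeg, hT⟩ := exists_blocking_set h3 hν (s - i) (i + 1) (by omega) (by
    intro j hij hjs
    by_contra hcon
    have := himax j (by omega) (not_lt.1 hcon)
    omega)
  have hTB : T = B i := by
    refine eq_of_subset_of_card_le (fun x hx => mem_filter.2 ⟨mem_univ x, ?_⟩) (by omega)
    exact lt_of_le_of_lt (Nat.mul_le_mul_right n (by omega)) (hTdeg x hx)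
  refine ⟨i, T, by omega, hTcard, ?_, ?_⟩
  · intro x hx
    by_contra hcon
    exact hx (hTB ▸ mem_filter.2 ⟨mem_univ x, not_le.1 hcon⟩)
  · intro M hM hMdis
    by_contra hcon
    obtain ⟨N, hNM, hN⟩ := exists_subset_card_eq (show i + 1 ≤ M.card by omega)
    exact hT N (fun e he => (mem_filter.1 (hM (hNM he))).1)
      (fun e he f hf => hMdis e (hNM he) f (hNM hf))
      (fun e he => (mem_filter.1 (hM (hNM he))).2) hN

/-- Edges are split according to how they meet `A` and `S`. -/
theorem card_le_sum_add_sum {n : ℕ} {H : Finset (Finset (Fin n))} (h3 : IsThreeGraph H)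
    (A S : Finset (Fin n)) :
    H.card ≤ (∑ v ∈ A, degW H v (univ \ S)) +
      (∑ p ∈ powersetCard 2 A, (univ.filter (fun w : Fin n => insert w p ∈ H)).card) +
      (∑ v ∈ S \ A, degH H v) + (H.filter (Disjoint · S)).card := by
  have hsub : H ⊆ (A.biUnion fun v =>
        ((powersetCard 2 (univ \ S)).filter (fun p => insert v p ∈ H)).image (insert v)) ∪
      ((powersetCard 2 A).biUnion fun p => H.filter (p ⊆ ·)) ∪
      ((S \ A).biUnion fun v => H.filter (v ∈ ·)) ∪ H.filter (Disjoint · S) := by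
    intro e he
    simp only [mem_union, or_assoc]
    by_cases hdis : Disjoint e S
    · exact Or.inr (Or.inr (Or.inr (mem_filter.2 ⟨he, hdis⟩)))
    by_cases hSA : ∃ v ∈ S \ A, v ∈ e
    · obtain ⟨v, hv, hve⟩ := hSA
      exact Or.inr (Or.inr (Or.inl (mem_biUnion.2 ⟨v, hv, mem_filter.2 ⟨he, hve⟩⟩)))
    push Not at hSA
    have hA : ∀ x ∈ e, x ∈ S → x ∈ A := fun x hx hxS => by
      by_contra hxA
      exact hSA x (mem_sdiff.2 ⟨hxS, hxA⟩) hx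
    obtain ⟨v, hve, hvS⟩ := not_disjoint_iff.1 hdis
    have hvA := hA v hve hvS
    by_cases h2 : ∃ u ∈ e, u ∈ A ∧ u ≠ v
    · obtain ⟨u, hue, huA, huv⟩ := h2
      refine Or.inr (Or.inl (mem_biUnion.2 ⟨{u, v}, mem_powersetCard.2 ⟨?_, card_pair huv⟩,
        mem_filter.2 ⟨he, ?_⟩⟩))
      · simp [insert_subset_iff, huA, hvA]
      · simp [insert_subset_iff, hue, hve]
    · push Not at h2
      refine Or.inl (mem_biUnion.2 ⟨v, hvA, mem_image.2 ⟨e.erase v, mem_filter.2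
        ⟨mem_powersetCard.2 ⟨fun x hx => ?_, ?_⟩, ?_⟩, insert_erase hve⟩⟩)
      · obtain ⟨hxv, hxe⟩ := mem_erase.1 hx
        exact mem_sdiff.2 ⟨mem_univ x, fun hxS => hxv (h2 x hxe (hA x hxe hxS))⟩
      · rw [card_erase_of_mem hve, h3 e he]
      · rwa [insert_erase hve]
  refine (card_le_card hsub).trans ((card_union_le _ _).trans (Nat.add_le_add_right ?_ _))
  refine (card_union_le _ _).trans (add_le_add ?_ card_biUnion_le)
  refine (card_union_le _ _).trans (add_le_add ?_ ?_)
  · exact card_biUnion_le.trans (sum_le_sum fun v _ => card_image_le)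
  · exact card_biUnion_le.trans (sum_le_sum fun p hp =>
      card_filter_pair_subset_le h3 (mem_powersetCard.1 hp).2)

theorem structure_lemma (n s : ℕ) (hs : 2 ≤ s) (hn : 3 * (s + 1) ≤ n)
    (H : Finset (Finset (Fin n))) (h3 : IsThreeGraph H) (hν : MatchingNumLE H s) :
    ∃ (i : ℕ) (A S : Finset (Fin n)), i ≤ s ∧ A ⊆ S ∧ A.card = s - i ∧ S.card = s ∧
      (∀ x : Fin n, x ∉ A → degH H x ≤ (s + 2 * i) * n) ∧
      H.card ≤ (∑ v ∈ A, degW H v (Finset.univ \ S)) +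
        (∑ pr ∈ Finset.powersetCard 2 A,
          (Finset.univ.filter (fun w : Fin n => insert w pr ∈ H)).card) +
        i * s * n + 6 * i ^ 2 * n := by
  obtain ⟨i, A, his, hAcard, hAdeg, hAν⟩ := exists_heavy_level h3 hν
  obtain ⟨R, hRcard, hR⟩ := exists_card_filter_disjoint_le (by omega : 4 ≤ n)
    (fun e he => h3 e (mem_filter.1 he).1) hAν
  obtain ⟨S, hARS, -, hScard⟩ := exists_subsuperset_card_eq (subset_univ (A ∪ R))
    (show (A ∪ R).card ≤ s by have := card_union_le A R; omega)
    (show s ≤ (univ : Finset (Fin n)).card by rw [card_univ, Fintype.card_fin]; omega)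
  have hAS : A ⊆ S := subset_union_left.trans hARS
  refine ⟨i, A, S, his, hAS, hAcard, hScard, hAdeg, (card_le_sum_add_sum h3 A S).trans ?_⟩
  have hSA : ∑ v ∈ S \ A, degH H v ≤ i * ((s + 2 * i) * n) := by
    have hcard : (S \ A).card = i := by
      rw [card_sdiff_of_subset hAS]
      omega
    have := sum_le_card_nsmul (S \ A) (degH H) ((s + 2 * i) * n) fun v hv => hAdeg v (mem_sdiff.1 hv).2
    rwa [hcard, smul_eq_mul] at this
  have hrest : (H.filter (Disjoint · S)).card ≤ 4 * i ^ 2 * n := by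
    refine (card_le_card fun e he => ?_).trans hR
    obtain ⟨heH, heS⟩ := mem_filter.1 he
    exact mem_filter.2 ⟨mem_filter.2 ⟨heH, heS.mono_right hAS⟩,
      heS.mono_right (subset_union_right.trans hARS)⟩
  have hring : i * ((s + 2 * i) * n) + 4 * i ^ 2 * n = i * s * n + 6 * i ^ 2 * n := by ring
  omega
end

section
/- Let s ≥ 2, n ≥ 3(s+1), and let H be a 3-graph on vertex set [n] with matching number ν(H) ≤ s, whose vertices are labelled so that deg_H(1) ≥ deg_H(2) ≥ ⋯ ≥ deg_H(n). Then there exists an integer i with 0 ≤ i ≤ s such that deg_H(s+1−i) ≤ (s+2i)n; equivalently, for some 0 ≤ i ≤ s, the (s+1−i)-th largest vertex degree of H is at most (s+2i)n. -/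
open Finset

/-- If `v ∉ T` lies in more than `|T|·n` edges, one of them avoids `T`. -/
theorem exists_edge_disjoint {n : ℕ} {H : Finset (Finset (Fin n))} (h3 : IsThreeGraph H)
    {v : Fin n} {T : Finset (Fin n)} (hv : v ∉ T) (hdeg : T.card * n < degH H v) :
    ∃ e ∈ H, v ∈ e ∧ Disjoint e T := by
  by_contra! hcon
  have hsub : H.filter (fun e => v ∈ e) ⊆
      (T ×ˢ (univ : Finset (Fin n))).image (fun p => {v, p.1, p.2}) := by
    intro e he
    obtain ⟨heH, hve⟩ := mem_filter.mp he
    obtain ⟨t, hte, htT⟩ := not_disjoint_iff.mp (hcon e heH hve)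
    have htv : t ≠ v := fun h => hv (h ▸ htT)
    have hcard : ((e.erase v).erase t).card = 1 := by
      rw [card_erase_of_mem (mem_erase.mpr ⟨htv, hte⟩), card_erase_of_mem hve, h3 e heH]
    obtain ⟨w, hw⟩ := card_eq_one.mp hcard
    refine mem_image.mpr ⟨(t, w), by simp [htT], ?_⟩
    change insert v (insert t {w}) = e
    rw [← hw, insert_erase (mem_erase.mpr ⟨htv, hte⟩), insert_erase hve]
  have hle := (card_le_card hsub).trans card_image_le
  rw [card_product, card_univ, Fintype.card_fin] at hle
  exact absurd hdeg (not_lt.mpr hle)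

/-- Greedy construction of a matching of size `k` covering `v 0, …, v (k - 1)` and avoiding
the remaining `v i`, when the degrees of the `v i` grow fast enough. -/
theorem exists_matching_of_degrees {n s : ℕ} {H : Finset (Finset (Fin n))}
    (h3 : IsThreeGraph H) (v : ℕ → Fin n) (hinj : Set.InjOn v (Set.Iic s))
    (hdeg : ∀ i ≤ s, (s + 2 * i) * n < degH H (v i)) (k : ℕ) (hk : k ≤ s + 1) :
    ∃ M ⊆ H, (∀ e ∈ M, ∀ f ∈ M, e ≠ f → Disjoint e f) ∧ M.card = k ∧
      ((range (s + 1)).image v ∪ M.biUnion id).card ≤ s + 1 + 2 * k ∧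
      ∀ i, k ≤ i → i ≤ s → v i ∉ M.biUnion id := by
  induction k with
  | zero =>
    refine ⟨∅, by simp, by simp, rfl, ?_, by simp⟩
    simpa using card_image_le (s := range (s + 1)) (f := v)
  | succ k ih =>
    obtain ⟨M, hMH, hdisj, hcard, hunion, havoid⟩ := ih (by omega)
    set U := (range (s + 1)).image v ∪ M.biUnion id with hU
    have hvU : ∀ i ≤ s, v i ∈ U := fun i hi =>
      mem_union_left _ (mem_image_of_mem v (mem_range.mpr (by omega)))
    have hkU := hvU k (by omega)
    have hT : (U.erase (v k)).card ≤ s + 2 * k := by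
      rw [card_erase_of_mem hkU]; omega
    obtain ⟨e, heH, hve, heT⟩ := exists_edge_disjoint h3 (notMem_erase (v k) U)
      ((Nat.mul_le_mul_right n hT).trans_lt (hdeg k (by omega)))
    have hvM := havoid k le_rfl (by omega)
    have heM : e ∉ M := fun h => hvM (mem_biUnion.mpr ⟨e, h, hve⟩)
    have hedisj : ∀ f ∈ M, Disjoint e f := by
      intro f hf
      refine heT.mono_right fun x hx => ?_
      have hxM : x ∈ M.biUnion id := mem_biUnion.mpr ⟨f, hf, hx⟩
      exact mem_erase.mpr ⟨fun h => hvM (h ▸ hxM), mem_union_right _ hxM⟩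
    refine ⟨insert e M, insert_subset heH hMH, ?_, by rw [card_insert_of_notMem heM, hcard], ?_, ?_⟩
    · intro f hf g hg hfg
      rcases mem_insert.mp hf with rfl | hfM <;> rcases mem_insert.mp hg with rfl | hgM
      · exact absurd rfl hfg
      · exact hedisj g hgM
      · exact (hedisj f hfM).symm
      · exact hdisj f hfM g hgM hfg
    · have hsub : (range (s + 1)).image v ∪ (insert e M).biUnion id ⊆ U ∪ e.erase (v k) := by
        intro x hx
        by_cases hxk : x = v k
        · exact mem_union_left _ (hxk ▸ hkU)
        · simp only [hU, mem_union, biUnion_insert, mem_erase, id] at hx ⊢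
          tauto
      have h1 := (card_le_card hsub).trans (card_union_le _ _)
      rw [card_erase_of_mem hve, h3 e heH] at h1
      omega
    · intro i hki his
      rw [biUnion_insert, mem_union, not_or]
      refine ⟨fun hie => disjoint_left.mp heT hie (mem_erase.mpr ⟨fun h => ?_, hvU i his⟩),
        havoid i (by omega) his⟩
      have := hinj (Set.mem_Iic.mpr his) (Set.mem_Iic.mpr (by omega : k ≤ s)) h
      omega

/-- If the vertices are labelled so that `deg(1) ≥ deg(2) ≥ ⋯ ≥ deg(n)`
(vertex `k` of `[n]` being `⟨k - 1, _⟩ : Fin n`), then there is `0 ≤ i ≤ s`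
with `deg(s + 1 - i) ≤ (s + 2i)·n`. -/
theorem degree_claim (n s : ℕ) (hs : 2 ≤ s) (hn : 3 * (s + 1) ≤ n)
    (H : Finset (Finset (Fin n))) (h3 : IsThreeGraph H) (hν : MatchingNumLE H s)
    (hsorted : ∀ u v : Fin n, u ≤ v → degH H v ≤ degH H u) :
    ∃ i : ℕ, i ≤ s ∧ degH H (⟨s - i, by omega⟩ : Fin n) ≤ (s + 2 * i) * n := by
  by_contra! hcon
  have hinj : Set.InjOn (fun i : ℕ => (⟨s - i, by omega⟩ : Fin n)) (Set.Iic s) := by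
    intro i hi j hj hij
    simp only [Set.mem_Iic, Fin.mk.injEq] at hi hj hij
    omega
  obtain ⟨M, hMH, hdisj, hcard, -⟩ :=
    exists_matching_of_degrees h3 _ hinj hcon (s + 1) le_rfl
  have := hν M hMH hdisj
  omega
end

section
/- Let H be an F_5-free 3-graph on vertex set [n], let t ≥ 1 with n ≥ 2t + 3, and suppose E_1,…,E_t ∈ H are edges such that 1 ∉ E_j and 2 ∈ E_j for every j, and E_i ∩ E_j = {2} for all 1 ≤ i < j ≤ t. Then the degree of the vertex 1 satisfies deg_H(1) ≤ C(n−1,2) − (t+1)n + t² + 3t + 4. -/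
open Finset

/-- `H` is `F₅`-free: there are no five distinct vertices `a b c d e` with
`{a,b,c}, {a,b,d}, {c,d,e} ∈ H`. -/
def F5Free {n : ℕ} (H : Finset (Finset (Fin n))) : Prop :=
  ¬ ∃ a b c d e : Fin n, ({a, b, c, d, e} : Finset (Fin n)).card = 5 ∧
      ({a, b, c} : Finset (Fin n)) ∈ H ∧ ({a, b, d} : Finset (Fin n)) ∈ H ∧
      ({c, d, e} : Finset (Fin n)) ∈ H

/-- Ordered adjacency indicator of the link of `u` in `H`. -/
def linkInd {n : ℕ} (H : Finset (Finset (Fin n))) (u v w : Fin n) : ℤ :=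
  if ({u, v, w} : Finset (Fin n)) ∈ H then 1 else 0

section Link

variable {n : ℕ} {H : Finset (Finset (Fin n))}

lemma linkInd_symm (u v w : Fin n) : linkInd H u v w = linkInd H u w v := by
  unfold linkInd
  rw [show ({u, v, w} : Finset (Fin n)) = {u, w, v} by rw [Finset.pair_comm v w]]

lemma linkInd_nonneg (u v w : Fin n) : 0 ≤ linkInd H u v w := by
  unfold linkInd; split_ifs <;> norm_num

lemma linkInd_le_one (u v w : Fin n) : linkInd H u v w ≤ 1 := by
  unfold linkInd; split_ifs <;> norm_num

lemma linkInd_self_left (h3 : IsThreeGraph H) (u w : Fin n) : linkInd H u u w = 0 := by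
  unfold linkInd
  rw [if_neg]
  intro h
  have h' := h3 _ h
  have := Finset.card_le_two (a := u) (b := w)
  simp at h'
  omega

lemma linkInd_diag (h3 : IsThreeGraph H) (u v : Fin n) : linkInd H u v v = 0 := by
  unfold linkInd
  rw [if_neg]
  intro h
  have h' := h3 _ h
  have := Finset.card_le_two (a := u) (b := v)
  simp at h'
  omega

/-- In an `F₅`-free 3-graph, a vertex outside an edge `e` has at most one neighbour in `e`
in the link of a vertex outside `e`. -/
lemma sum_linkInd_edge_le_one (h3 : IsThreeGraph H) (hF5 : F5Free H) {u v : Fin n}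
    {e : Finset (Fin n)} (he : e ∈ H) (hu : u ∉ e) (hv : v ∉ e) :
    ∑ w ∈ e, linkInd H u v w ≤ 1 := by
  unfold linkInd
  rw [Finset.sum_boole]
  norm_cast
  rw [Finset.card_le_one]
  intro x hx y hy
  rw [Finset.mem_filter] at hx hy
  by_contra hxy
  have huv : u ≠ v := by
    rintro rfl
    have := linkInd_self_left h3 u x
    rw [linkInd, if_pos hx.2] at this
    exact one_ne_zero this
  have hc := h3 e he
  have hcard : ((e.erase x).erase y).card = 1 := by
    rw [Finset.card_erase_of_mem (Finset.mem_erase.2 ⟨Ne.symm hxy, hy.1⟩),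
      Finset.card_erase_of_mem hx.1, hc]
  obtain ⟨c, hc'⟩ := Finset.card_eq_one.1 hcard
  have hee : ({x, y, c} : Finset (Fin n)) = e := by
    rw [← hc', Finset.insert_erase (Finset.mem_erase.2 ⟨Ne.symm hxy, hy.1⟩),
      Finset.insert_erase hx.1]
  refine hF5 ⟨u, v, x, y, c, ?_, hx.2, hy.2, hee ▸ he⟩
  rw [hee, Finset.card_insert_of_notMem, Finset.card_insert_of_notMem hv, hc]
  simp [huv, hu]

/-- The handshake inequality in the link of a vertex. -/
lemma two_mul_degH_le (h3 : IsThreeGraph H) (u : Fin n) :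
    2 * (degH H u : ℤ) ≤ ∑ v, ∑ w, linkInd H u v w := by
  unfold linkInd
  rw [← Finset.sum_product', Finset.sum_boole]
  norm_cast
  unfold degH
  refine Finset.mul_card_image_le_card_of_maps_to
    (f := fun p : Fin n × Fin n => {u, p.1, p.2}) ?_ 2 ?_
  · intro p hp
    simpa using hp
  · intro e he
    rw [Finset.mem_filter] at he
    obtain ⟨x, y, hxy, hexy⟩ := Finset.card_eq_two.1
      (show (e.erase u).card = 2 by rw [Finset.card_erase_of_mem he.2, h3 e he.1])
    have hxe : ({u, x, y} : Finset (Fin n)) = e := by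
      rw [← hexy, Finset.insert_erase he.2]
    have hye : ({u, y, x} : Finset (Fin n)) = e := by rw [Finset.pair_comm y x, hxe]
    have hpair : ({(x, y), (y, x)} : Finset (Fin n × Fin n)).card = 2 :=
      Finset.card_pair fun h => hxy (congrArg Prod.fst h)
    rw [← hpair]
    refine Finset.card_le_card fun p hp => ?_
    rw [Finset.mem_insert, Finset.mem_singleton] at hp
    rcases hp with rfl | rfl
    · simp [hxe, he.1]
    · simp [hye, he.1]

end Link

/-- Total mass of a symmetric `0`-`1` matrix on a sunflower with kernel `c` and two-element
petals `P j`. -/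
lemma sum_sunflower_le {α : Type*} [DecidableEq α] {t : ℕ} (ht : 1 ≤ t) (f : α → α → ℤ)
    (hf0 : ∀ v w, 0 ≤ f v w) (hf1 : ∀ v w, f v w ≤ 1) (hsymm : ∀ v w, f v w = f w v)
    (hdiag : ∀ v, f v v = 0) (c : α) (P : Fin t → Finset α) (hP : ∀ j, (P j).card = 2)
    (hrow : ∀ j, ∀ v, v ≠ c → v ∉ P j → f v c + ∑ w ∈ P j, f v w ≤ 1)
    (hdisj : ∀ i j, i ≠ j → Disjoint (P i) (P j)) (hc : ∀ j, c ∉ P j) :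
    ∑ v ∈ insert c (univ.biUnion P), ∑ w ∈ insert c (univ.biUnion P), f v w
      ≤ 2 * (t : ℤ) ^ 2 + 4 := by
  have hcU : c ∉ univ.biUnion P := by simp [hc]
  have hsplit : ∀ g : α → ℤ, ∑ w ∈ insert c (univ.biUnion P), g w
      = g c + ∑ j, ∑ w ∈ P j, g w := by
    intro g
    rw [Finset.sum_insert hcU, Finset.sum_biUnion fun i _ j _ hij => hdisj i j hij]
  have hpetal : ∀ i, ∀ v ∈ P i,
      ∑ w ∈ insert c (univ.biUnion P), f v w ≤ t + (2 - t) * f v c := by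
    intro i v hv
    have hvc : v ≠ c := fun h => hc i (h ▸ hv)
    have hown : ∑ w ∈ P i, f v w ≤ 1 := by
      rw [← Finset.add_sum_erase _ _ hv, hdiag, zero_add]
      refine (Finset.sum_le_card_nsmul _ _ 1 fun w _ => hf1 v w).trans ?_
      simp [Finset.card_erase_of_mem hv, hP]
    have hoth : ∑ j ∈ univ.erase i, (f v c + ∑ w ∈ P j, f v w) ≤ (t : ℤ) - 1 := by
      refine (Finset.sum_le_card_nsmul _ _ 1 fun j hj => hrow j v hvc fun h => ?_).trans ?_
      · exact Finset.disjoint_left.1 (hdisj j i (Finset.ne_of_mem_erase hj)) h hv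
      · simp [Finset.card_erase_of_mem, ht]
    rw [Finset.sum_add_distrib, Finset.sum_const, Finset.card_erase_of_mem (mem_univ i)] at hoth
    simp only [card_univ, Fintype.card_fin, nsmul_eq_mul, Nat.cast_sub ht, Nat.cast_one] at hoth
    rw [hsplit, ← Finset.add_sum_erase _ _ (mem_univ i)]
    linarith
  have hcol : ∑ j, ∑ w ∈ P j, f c w ≤ 2 * t := by
    have : ∀ j ∈ (univ : Finset (Fin t)), ∑ w ∈ P j, f c w ≤ 2 := fun j _ => by
      refine (Finset.sum_le_card_nsmul _ _ 1 fun w _ => hf1 c w).trans ?_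
      simp [hP]
    refine (Finset.sum_le_card_nsmul _ _ 2 this).trans ?_
    simp [mul_comm]
  have hcol0 : 0 ≤ ∑ j, ∑ w ∈ P j, f c w :=
    Finset.sum_nonneg fun j _ => Finset.sum_nonneg fun w _ => hf0 c w
  have htot : ∑ j, ∑ v ∈ P j, ∑ w ∈ insert c (univ.biUnion P), f v w
      ≤ ∑ j, ∑ v ∈ P j, ((t : ℤ) + (2 - t) * f c v) :=
    Finset.sum_le_sum fun j _ => Finset.sum_le_sum fun v hv => by
      rw [hsymm c v]; exact hpetal j v hv
  simp only [Finset.sum_add_distrib, ← Finset.mul_sum, Finset.sum_const, hP, card_univ,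
    Fintype.card_fin, nsmul_eq_mul] at htot
  rw [hsplit, hsplit, hdiag]
  set a := ∑ j, ∑ w ∈ P j, f c w
  have hfin : (3 - (t : ℤ)) * a ≤ 4 := by
    obtain rfl | rfl | h : t = 1 ∨ t = 2 ∨ 3 ≤ t := by omega
    · norm_num at *; linarith
    · norm_num at *; linarith
    · have : (3 : ℤ) ≤ t := by exact_mod_cast h
      nlinarith
  push_cast at htot
  nlinarith

/-- Total mass of a symmetric `0`-`1` matrix that has few entries between `S` and its
complement `O`. -/
lemma sum_union_le {α : Type*} [DecidableEq α] (f : α → α → ℤ) (hf1 : ∀ v w, f v w ≤ 1)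
    (hsymm : ∀ v w, f v w = f w v) (hdiag : ∀ v, f v v = 0) {S O : Finset α}
    (hSO : Disjoint S O) {s r : ℤ} (hS : ∑ v ∈ S, ∑ w ∈ S, f v w ≤ s)
    (hO : ∀ v ∈ O, ∑ w ∈ S, f v w ≤ r) :
    ∑ v ∈ S ∪ O, ∑ w ∈ S ∪ O, f v w ≤ s + 2 * (O.card * r) + O.card * (O.card - 1) := by
  have hOS : ∑ v ∈ O, ∑ w ∈ S, f v w ≤ O.card * r := by
    simpa using Finset.sum_le_card_nsmul _ _ r hO
  have hcomm : ∑ v ∈ S, ∑ w ∈ O, f v w = ∑ v ∈ O, ∑ w ∈ S, f v w := by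
    rw [Finset.sum_comm]
    simp only [hsymm]
  have hOO : ∑ v ∈ O, ∑ w ∈ O, f v w ≤ O.card * ((O.card : ℤ) - 1) := by
    have : ∀ v ∈ O, ∑ w ∈ O, f v w ≤ (O.card : ℤ) - 1 := fun v hv => by
      rw [← Finset.add_sum_erase _ _ hv, hdiag, zero_add]
      refine (Finset.sum_le_card_nsmul _ _ 1 fun w _ => hf1 v w).trans ?_
      simp [Finset.cast_card_erase_of_mem hv]
    simpa using Finset.sum_le_card_nsmul _ _ _ this
  simp only [Finset.sum_union hSO, Finset.sum_add_distrib]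
  linarith

/-- Vertices `1` and `2` of `[n]` are `⟨0, _⟩` and `⟨1, _⟩ : Fin n`. -/
theorem degree_bound_sunflower (n t : ℕ) (ht : 1 ≤ t) (hn : 2 * t + 3 ≤ n)
    (H : Finset (Finset (Fin n))) (h3 : IsThreeGraph H) (hF5 : F5Free H)
    (E : Fin t → Finset (Fin n)) (hE : ∀ j, E j ∈ H)
    (h1 : ∀ j, (⟨0, by omega⟩ : Fin n) ∉ E j)
    (h2 : ∀ j, (⟨1, by omega⟩ : Fin n) ∈ E j)
    (hker : ∀ j k : Fin t, j ≠ k → E j ∩ E k = ({⟨1, by omega⟩} : Finset (Fin n))) :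
    (degH H (⟨0, by omega⟩ : Fin n) : ℤ) ≤
      ((n - 1).choose 2 : ℤ) - (t + 1) * (n : ℤ) + (t : ℤ) ^ 2 + 3 * (t : ℤ) + 4 := by
  classical
  set z : Fin n := ⟨0, by omega⟩
  set c : Fin n := ⟨1, by omega⟩
  have hzc : z ≠ c := by simp [z, c, Fin.ext_iff]
  let P : Fin t → Finset (Fin n) := fun j => (E j).erase c
  have hP : ∀ j, (P j).card = 2 := fun j => by
    simp only [P]
    rw [Finset.card_erase_of_mem (h2 j), h3 _ (hE j)]
  have hcP : ∀ j, c ∉ P j := fun j => Finset.notMem_erase _ _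
  have hdisj : ∀ i j, i ≠ j → Disjoint (P i) (P j) := fun i j hij => by
    rw [Finset.disjoint_left]
    intro x hxi hxj
    have hx : x ∈ E i ∩ E j :=
      Finset.mem_inter.2 ⟨Finset.mem_of_mem_erase hxi, Finset.mem_of_mem_erase hxj⟩
    rw [hker i j hij, Finset.mem_singleton] at hx
    exact Finset.ne_of_mem_erase hxi hx
  have hrow : ∀ j, ∀ v, v ≠ c → v ∉ P j →
      linkInd H z v c + ∑ w ∈ P j, linkInd H z v w ≤ 1 := fun j v hvc hv => by
    rw [Finset.add_sum_erase _ _ (h2 j)]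
    exact sum_linkInd_edge_le_one h3 hF5 (hE j) (h1 j) fun h =>
      hv (Finset.mem_erase.2 ⟨hvc, h⟩)
  have hcU : c ∉ univ.biUnion P := by simp [hcP]
  set S : Finset (Fin n) := insert c (univ.biUnion P) with hS
  have hScard : S.card = 2 * t + 1 := by
    rw [hS, Finset.card_insert_of_notMem hcU,
      Finset.card_biUnion fun i _ j _ hij => hdisj i j hij]
    simp [hP, mul_comm]
  have hzS : z ∉ S := by
    simp only [hS, P, Finset.mem_insert, Finset.mem_biUnion, Finset.mem_erase, not_or]
    exact ⟨hzc, fun ⟨j, _, _, h⟩ => h1 j h⟩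
  have hSz : S ⊆ univ.erase z := fun x hx =>
    Finset.mem_erase.2 ⟨fun h => hzS (h ▸ hx), mem_univ x⟩
  set O : Finset (Fin n) := univ.erase z \ S with hO
  have hOcard : O.card = n - 1 - (2 * t + 1) := by
    rw [hO, Finset.card_sdiff_of_subset hSz, hScard, Finset.card_erase_of_mem (mem_univ z)]
    simp
  have hSS := sum_sunflower_le ht (linkInd H z) (linkInd_nonneg z) (linkInd_le_one z)
    (linkInd_symm z) (linkInd_diag h3 z) c P hP hrow hdisj hcP
  have hOS : ∀ v ∈ O, ∑ w ∈ S, linkInd H z v w ≤ t := fun v hv => by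
    have hvS : v ∉ S := (Finset.mem_sdiff.1 hv).2
    have hvc : v ≠ c := fun h => hvS (h ▸ Finset.mem_insert_self _ _)
    have hvP : ∀ j, v ∉ P j := fun j h =>
      hvS (Finset.mem_insert_of_mem (Finset.mem_biUnion.2 ⟨j, mem_univ j, h⟩))
    have hle : ∑ j, (linkInd H z v c + ∑ w ∈ P j, linkInd H z v w) ≤ t := by
      refine (Finset.sum_le_card_nsmul _ _ 1 fun j _ => hrow j v hvc (hvP j)).trans ?_
      simp
    rw [Finset.sum_add_distrib, Finset.sum_const, card_univ, Fintype.card_fin,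
      nsmul_eq_mul] at hle
    rw [hS, Finset.sum_insert hcU, Finset.sum_biUnion fun i _ j _ hij => hdisj i j hij]
    have ht' : (1 : ℤ) ≤ t := by exact_mod_cast ht
    nlinarith [linkInd_nonneg (H := H) z v c]
  have hall := sum_union_le (linkInd H z) (linkInd_le_one z) (linkInd_symm z)
    (linkInd_diag h3 z) Finset.disjoint_sdiff hSS hOS
  rw [← hS, ← hO, hO, Finset.union_sdiff_of_subset hSz, ← hO] at hall
  have herase : ∑ v, ∑ w, linkInd H z v w
      = ∑ v ∈ univ.erase z, ∑ w ∈ univ.erase z, linkInd H z v w := by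
    rw [← Finset.add_sum_erase _ _ (mem_univ z)]
    simp only [linkInd_self_left h3, Finset.sum_const_zero, zero_add]
    refine Finset.sum_congr rfl fun v _ => ?_
    rw [← Finset.add_sum_erase _ _ (mem_univ z), linkInd_symm, linkInd_self_left h3, zero_add]
  have hdeg := two_mul_degH_le h3 z
  rw [herase] at hdeg
  obtain ⟨m, rfl⟩ : ∃ m, n = m + 2 * t + 2 := ⟨n - 2 * t - 2, by omega⟩
  have hm : O.card = m := by omega
  have hch : 2 * (((m + 2 * t + 2 - 1).choose 2 : ℕ) : ℤ)
      = ((m : ℤ) + 2 * t + 1) * (m + 2 * t) := by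
    rw [show m + 2 * t + 2 - 1 = m + 2 * t + 1 by omega, Nat.choose_two_right]
    have h2 := Nat.div_mul_cancel (Nat.even_mul_pred_self (m + 2 * t + 1)).two_dvd
    rw [mul_comm]
    have h3 : (((m + 2 * t + 1) * (m + 2 * t + 1 - 1) / 2 * 2 : ℕ) : ℤ)
      = (((m + 2 * t + 1) * (m + 2 * t + 1 - 1) : ℕ) : ℤ) := congrArg _ h2
    push_cast at h3
    simpa using h3
  rw [hm] at hall
  push_cast at *
  nlinarith
end

section
/- Let n ≥ 7 and let H be an F_5-free 3-graph on vertex set [n]. Suppose x_1,x_2,x_3,x_4,x_5 are five distinct vertices of [n] ∖ {1} such that {x_1,x_2,x_3} ∈ H and {x_3,x_4,x_5} ∈ H. Then the degree of the vertex 1 satisfies deg_H(1) ≤ C(n−1,2) − 3n + 14. -/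
open Finset

/-- The vertices of `s` adjacent to `b` in the link of `v`. -/
def linkNbrs {n : ℕ} (H : Finset (Finset (Fin n))) (v b : Fin n) (s : Finset (Fin n)) :
    Finset (Fin n) :=
  s.filter fun x => ({v, b, x} : Finset (Fin n)) ∈ H

/-- The edges `{v, b, x}` of `H` with `x ∈ s`. -/
def linkStar {n : ℕ} (H : Finset (Finset (Fin n))) (v b : Fin n) (s : Finset (Fin n)) :
    Finset (Finset (Fin n)) :=
  (linkNbrs H v b s).image fun x => {v, b, x}

theorem mem_linkStar {n : ℕ} {H : Finset (Finset (Fin n))} {v b x : Fin n}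
    {s : Finset (Fin n)} (hx : x ∈ s) (h : ({v, b, x} : Finset (Fin n)) ∈ H) :
    ({v, b, x} : Finset (Fin n)) ∈ linkStar H v b s :=
  mem_image_of_mem _ (mem_filter.2 ⟨hx, h⟩)

theorem F5Free.not_adj_both {n : ℕ} {H : Finset (Finset (Fin n))} (hF5 : F5Free H)
    {v b c d e : Fin n} (hcard : ({v, b, c, d, e} : Finset (Fin n)).card = 5)
    (hc : ({v, b, c} : Finset (Fin n)) ∈ H) (hd : ({v, b, d} : Finset (Fin n)) ∈ H) :
    ({c, d, e} : Finset (Fin n)) ∉ H :=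
  fun he => hF5 ⟨v, b, c, d, e, hcard, hc, hd, he⟩

/-- A vertex outside an edge `s` not containing `v` has at most one link neighbour in `s`. -/
theorem F5Free.card_linkNbrs_le_one {n : ℕ} {H : Finset (Finset (Fin n))}
    (h3 : IsThreeGraph H) (hF5 : F5Free H) {v b : Fin n} {s : Finset (Fin n)} (hs : s ∈ H)
    (hv : v ∉ s) (hb : b ∉ s) (hvb : v ≠ b) : (linkNbrs H v b s).card ≤ 1 := by
  refine card_le_one.2 fun c hc d hd => ?_
  obtain ⟨hcs, hcH⟩ := mem_filter.1 hc
  obtain ⟨hds, hdH⟩ := mem_filter.1 hd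
  by_contra hcd
  have h1 : ((s.erase c).erase d).card = 1 := by
    rw [card_erase_of_mem (mem_erase.2 ⟨Ne.symm hcd, hds⟩), card_erase_of_mem hcs, h3 s hs]
  obtain ⟨e, he⟩ := card_eq_one.1 h1
  have hsE : ({c, d, e} : Finset (Fin n)) = s := by
    rw [← he, insert_erase (mem_erase.2 ⟨Ne.symm hcd, hds⟩), insert_erase hcs]
  refine hF5.not_adj_both (e := e) ?_ hcH hdH (hsE ▸ hs)
  rw [hsE, card_insert_of_notMem (by simp [hvb, hv]), card_insert_of_notMem hb, h3 s hs]

theorem F5Free.card_linkStar_le_one {n : ℕ} {H : Finset (Finset (Fin n))}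
    (h3 : IsThreeGraph H) (hF5 : F5Free H) {v b : Fin n} {s : Finset (Fin n)} (hs : s ∈ H)
    (hv : v ∉ s) (hb : b ∉ s) (hvb : v ≠ b) : (linkStar H v b s).card ≤ 1 :=
  card_image_le.trans (hF5.card_linkNbrs_le_one h3 hs hv hb hvb)

theorem card_union_seven_le {α : Type*} [DecidableEq α] (s a b c d t u : Finset α) :
    (s ∪ (a ∪ b ∪ c ∪ d) ∪ t ∪ u).card ≤
      s.card + (a.card + b.card + c.card + d.card) + t.card + u.card := by
  grw [card_union_le, card_union_le, card_union_le, card_union_le (a ∪ b ∪ c),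
    card_union_le (a ∪ b), card_union_le a]

/-- The edges at `v` are covered by two edges inside `{v, x₁, …, x₅}`, four stars centred at
`x₁, x₂, x₄, x₅`, two stars for every outer vertex, and the pairs of outer vertices. -/
theorem filter_mem_subset_cover {n : ℕ} {H : Finset (Finset (Fin n))} (h3 : IsThreeGraph H)
    (v x₁ x₂ x₃ x₄ x₅ : Fin n) :
    H.filter (fun e => v ∈ e) ⊆
      ({{v, x₁, x₂}, {v, x₄, x₅}} : Finset (Finset (Fin n))) ∪
      (linkStar H v x₁ {x₃, x₄, x₅} ∪ linkStar H v x₂ {x₃, x₄, x₅} ∪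
        linkStar H v x₄ {x₁, x₂, x₃} ∪ linkStar H v x₅ {x₁, x₂, x₃}) ∪
      (univ \ {v, x₁, x₂, x₃, x₄, x₅}).biUnion
        (fun w => linkStar H v w {x₁, x₂, x₃} ∪ linkStar H v w {x₃, x₄, x₅}) ∪
      (powersetCard 2 (univ \ {v, x₁, x₂, x₃, x₄, x₅})).image (insert v) := by
  intro e he
  obtain ⟨heH, hve⟩ := mem_filter.1 he
  have h2 : (e.erase v).card = 2 := by rw [card_erase_of_mem hve, h3 e heH]
  obtain ⟨y, z, hyz, hE⟩ := card_eq_two.1 h2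
  have hyv : y ≠ v := ne_of_mem_erase (s := e) (by simp [hE])
  have hzv : z ≠ v := ne_of_mem_erase (s := e) (by simp [hE])
  obtain rfl : e = {v, y, z} := by rw [← hE, insert_erase hve]
  have hsymm : ({v, y, z} : Finset (Fin n)) = {v, z, y} := by rw [pair_comm]
  have hstar : ∀ {b s}, b = y ∧ z ∈ s ∨ b = z ∧ y ∈ s →
      ({v, y, z} : Finset (Fin n)) ∈ linkStar H v b s := by
    rintro b s (⟨rfl, h⟩ | ⟨rfl, h⟩)
    · exact mem_linkStar h heH
    · rw [hsymm] at heH ⊢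
      exact mem_linkStar h heH
  simp only [mem_union, mem_biUnion]
  by_cases hy : y ∈ univ \ {v, x₁, x₂, x₃, x₄, x₅} <;>
    by_cases hz : z ∈ univ \ {v, x₁, x₂, x₃, x₄, x₅}
  · refine Or.inr (mem_image.2 ⟨{y, z}, mem_powersetCard.2 ⟨?_, card_pair hyz⟩, rfl⟩)
    exact insert_subset_iff.2 ⟨hy, singleton_subset_iff.2 hz⟩
  · refine Or.inl (Or.inr ⟨y, hy, ?_⟩)
    simp only [mem_sdiff, mem_univ, true_and, not_not, mem_insert, mem_singleton, hzv,
      false_or] at hz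
    have : z ∈ ({x₁, x₂, x₃} : Finset (Fin n)) ∨ z ∈ ({x₃, x₄, x₅} : Finset (Fin n)) := by
      simp only [mem_insert, mem_singleton]; tauto
    exact this.imp (fun h => hstar (Or.inl ⟨rfl, h⟩)) fun h => hstar (Or.inl ⟨rfl, h⟩)
  · refine Or.inl (Or.inr ⟨z, hz, ?_⟩)
    simp only [mem_sdiff, mem_univ, true_and, not_not, mem_insert, mem_singleton, hyv,
      false_or] at hy
    have : y ∈ ({x₁, x₂, x₃} : Finset (Fin n)) ∨ y ∈ ({x₃, x₄, x₅} : Finset (Fin n)) := by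
      simp only [mem_insert, mem_singleton]; tauto
    exact this.imp (fun h => hstar (Or.inr ⟨rfl, h⟩)) fun h => hstar (Or.inr ⟨rfl, h⟩)
  · refine Or.inl (Or.inl ?_)
    simp only [mem_sdiff, mem_univ, true_and, not_not, mem_insert, mem_singleton, hyv, hzv,
      false_or] at hy hz
    by_cases h12 : y = x₁ ∧ z = x₂ ∨ y = x₂ ∧ z = x₁
    · left
      rcases h12 with ⟨rfl, rfl⟩ | ⟨rfl, rfl⟩ <;> simp [hsymm]
    by_cases h45 : y = x₄ ∧ z = x₅ ∨ y = x₅ ∧ z = x₄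
    · left
      rcases h45 with ⟨rfl, rfl⟩ | ⟨rfl, rfl⟩ <;> simp [hsymm]
    right
    have : (x₁ = y ∧ z ∈ ({x₃, x₄, x₅} : Finset (Fin n)) ∨
          x₁ = z ∧ y ∈ ({x₃, x₄, x₅} : Finset (Fin n))) ∨
        (x₂ = y ∧ z ∈ ({x₃, x₄, x₅} : Finset (Fin n)) ∨
          x₂ = z ∧ y ∈ ({x₃, x₄, x₅} : Finset (Fin n))) ∨
        (x₄ = y ∧ z ∈ ({x₁, x₂, x₃} : Finset (Fin n)) ∨
          x₄ = z ∧ y ∈ ({x₁, x₂, x₃} : Finset (Fin n))) ∨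
        (x₅ = y ∧ z ∈ ({x₁, x₂, x₃} : Finset (Fin n)) ∨
          x₅ = z ∧ y ∈ ({x₁, x₂, x₃} : Finset (Fin n))) := by
      simp only [mem_insert, mem_singleton]
      grind
    rcases this with h | h | h | h
    · exact Or.inl (Or.inl (Or.inl (hstar h)))
    · exact Or.inl (Or.inl (Or.inr (hstar h)))
    · exact Or.inl (Or.inr (hstar h))
    · exact Or.inr (hstar h)

theorem add_five_choose_two (m : ℕ) : (m + 5).choose 2 = m.choose 2 + 5 * m + 10 := by
  simp only [Nat.choose_succ_succ' _ 1, Nat.choose_one_right]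
  ring

theorem F5Free.degH_le {n : ℕ} {H : Finset (Finset (Fin n))} (h3 : IsThreeGraph H)
    (hF5 : F5Free H) {v x₁ x₂ x₃ x₄ x₅ : Fin n}
    (hdistinct : ({x₁, x₂, x₃, x₄, x₅} : Finset (Fin n)).card = 5)
    (hne1 : v ∉ ({x₁, x₂, x₃, x₄, x₅} : Finset (Fin n)))
    (he1 : ({x₁, x₂, x₃} : Finset (Fin n)) ∈ H) (he2 : ({x₃, x₄, x₅} : Finset (Fin n)) ∈ H) :
    degH H v ≤ 2 + (1 + 1 + 1 + 1) + (n - 6) * 2 + (n - 6).choose 2 := by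
  have h6 : ({v, x₁, x₂, x₃, x₄, x₅} : Finset (Fin n)).card = 6 := by
    rw [card_insert_of_notMem hne1, hdistinct]
  have hv1 : v ∉ ({x₁, x₂, x₃} : Finset (Fin n)) := by
    simp only [mem_insert, mem_singleton] at hne1 ⊢; tauto
  have hv2 : v ∉ ({x₃, x₄, x₅} : Finset (Fin n)) := by
    simp only [mem_insert, mem_singleton] at hne1 ⊢; tauto
  have hdisj : Disjoint ({x₁, x₂} : Finset (Fin n)) {x₃, x₄, x₅} := by
    refine card_union_eq_card_add_card.1 (le_antisymm (card_union_le _ _) ?_)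
    have : ({x₁, x₂} ∪ {x₃, x₄, x₅} : Finset (Fin n)) = {x₁, x₂, x₃, x₄, x₅} := by
      ext; simp; tauto
    rw [this, hdistinct, h3 _ he2]
    have := card_le_two (a := x₁) (b := x₂)
    omega
  have hdisj' : Disjoint ({x₄, x₅} : Finset (Fin n)) {x₁, x₂, x₃} := by
    refine card_union_eq_card_add_card.1 (le_antisymm (card_union_le _ _) ?_)
    have : ({x₄, x₅} ∪ {x₁, x₂, x₃} : Finset (Fin n)) = {x₁, x₂, x₃, x₄, x₅} := by
      ext; simp; tauto
    rw [this, hdistinct, h3 _ he1]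
    have := card_le_two (a := x₄) (b := x₅)
    omega
  have hne : ∀ {b}, b ∈ ({x₁, x₂, x₃, x₄, x₅} : Finset (Fin n)) → v ≠ b :=
    fun hb h => hne1 (h ▸ hb)
  have s1 := hF5.card_linkStar_le_one h3 he2 hv2
    (disjoint_left.1 hdisj (by simp : x₁ ∈ _)) (hne (by simp))
  have s2 := hF5.card_linkStar_le_one h3 he2 hv2
    (disjoint_left.1 hdisj (by simp : x₂ ∈ _)) (hne (by simp))
  have s4 := hF5.card_linkStar_le_one h3 he1 hv1
    (disjoint_left.1 hdisj' (by simp : x₄ ∈ _)) (hne (by simp))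
  have s5 := hF5.card_linkStar_le_one h3 he1 hv1
    (disjoint_left.1 hdisj' (by simp : x₅ ∈ _)) (hne (by simp))
  have hcover := card_le_card (filter_mem_subset_cover h3 v x₁ x₂ x₃ x₄ x₅)
  set W : Finset (Fin n) := univ \ {v, x₁, x₂, x₃, x₄, x₅} with hW
  have hWcard : W.card = n - 6 := by
    rw [hW, card_sdiff_of_subset (subset_univ _), h6, card_univ, Fintype.card_fin]
  have hout : (W.biUnion fun w =>
      linkStar H v w {x₁, x₂, x₃} ∪ linkStar H v w {x₃, x₄, x₅}).card ≤ W.card * 2 := by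
    refine card_biUnion_le_card_mul _ _ _ fun w hw => ?_
    simp only [hW, mem_sdiff, mem_univ, true_and, mem_insert, mem_singleton, not_or] at hw
    have t1 := hF5.card_linkStar_le_one h3 he1 hv1 (b := w) (by simp [hw]) (Ne.symm hw.1)
    have t2 := hF5.card_linkStar_le_one h3 he2 hv2 (b := w) (by simp [hw]) (Ne.symm hw.1)
    exact (card_union_le _ _).trans (by omega)
  have hpairs : ((powersetCard 2 W).image (insert v)).card ≤ W.card.choose 2 :=
    card_image_le.trans (card_powersetCard 2 W).le
  have htwo := card_le_two (a := ({v, x₁, x₂} : Finset (Fin n))) (b := {v, x₄, x₅})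
  rw [hWcard] at hout hpairs
  exact hcover.trans ((card_union_seven_le _ _ _ _ _ _ _).trans
      (add_le_add (add_le_add (add_le_add htwo (add_le_add (add_le_add (add_le_add s1 s2) s4) s5))
        hout) hpairs))

/-- Vertex `1` of `[n]` is `⟨0, _⟩ : Fin n`. -/
theorem degree_bound_two_edges (n : ℕ) (hn : 7 ≤ n)
    (H : Finset (Finset (Fin n))) (h3 : IsThreeGraph H) (hF5 : F5Free H)
    (x₁ x₂ x₃ x₄ x₅ : Fin n)
    (hdistinct : ({x₁, x₂, x₃, x₄, x₅} : Finset (Fin n)).card = 5)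
    (hne1 : (⟨0, by omega⟩ : Fin n) ∉ ({x₁, x₂, x₃, x₄, x₅} : Finset (Fin n)))
    (he1 : ({x₁, x₂, x₃} : Finset (Fin n)) ∈ H)
    (he2 : ({x₃, x₄, x₅} : Finset (Fin n)) ∈ H) :
    (degH H (⟨0, by omega⟩ : Fin n) : ℤ) ≤
      ((n - 1).choose 2 : ℤ) - 3 * (n : ℤ) + 14 := by
  have hdeg := hF5.degH_le h3 hdistinct hne1 he1 he2
  obtain ⟨m, rfl⟩ := Nat.exists_eq_add_of_le (show 6 ≤ n by omega)
  rw [Nat.add_sub_cancel_left] at hdeg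
  rw [show 6 + m - 1 = m + 5 by omega, add_five_choose_two]
  push_cast
  omega
end
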